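/- For any three partitions α, β₁, β₂, one has β₁ + (α ⊔ β₂) ≥ α ⊔ (β₁ + β₂) in the dominance order (both sides are partitions of |α| + |β₁| + |β₂|). -/

import Mathlib

/-- A partition: a finite multiset of positive integers. -/
def IsPartition (p : Multiset ℕ) : Prop := ∀ x ∈ p, 0 < x

/-- The parts of `p` in weakly decreasing order. -/
def descList (p : Multiset ℕ) : List ℕ := (p.sort (· ≤ ·)).reverse

/-- The sum of the `j` largest parts of `p` (padding with trailing zeros). -/
def topSum (p : Multiset ℕ) (j : ℕ) : ℕ := ((descList p).take j).sum

/-- Dominance order: `DomLE α β` means `α ≤ β`, i.e. each partial sum of the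
largest parts of `α` is at most the corresponding partial sum for `β`. -/
def DomLE (α β : Multiset ℕ) : Prop := ∀ j : ℕ, topSum α j ≤ topSum β j

/-- Transpose of a partition: the `j`-th part is the number of parts `≥ j`. -/
def transposeP (p : Multiset ℕ) : Multiset ℕ :=
  ((Multiset.range p.sum).map fun j => (p.filter fun x => j + 1 ≤ x).card).filter
    fun c => c ≠ 0

/-- The weakly decreasing list of parts padded with zeros to length `n`. -/
def padDesc (p : Multiset ℕ) (n : ℕ) : List ℕ :=
  descList p ++ List.replicate (n - Multiset.card p) 0

/-- The sum of two partitions: add the parts pointwise after sorting in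
weakly decreasing order and padding with trailing zeros. -/
def sumParts (p q : Multiset ℕ) : Multiset ℕ :=
  (↑(List.zipWith (· + ·)
      (padDesc p (max (Multiset.card p) (Multiset.card q)))
      (padDesc q (max (Multiset.card p) (Multiset.card q)))) : Multiset ℕ).filter
    fun x => x ≠ 0

/-- The string `[a] = (a, a-2, a-4, …, 2 or 1)`, empty for `a = 0`. -/
def strP (a : ℕ) : Multiset ℕ := (Multiset.range ((a + 1) / 2)).map fun k => a - 2 * k

/-- The partition `(a, a-1, …, 2, 1)`. -/
def downP (a : ℕ) : Multiset ℕ := (Multiset.range a).map fun k => a - k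

/-- The partition `(2a-1, 2a-3, …, 3, 1)`. -/
def oddsDown (a : ℕ) : Multiset ℕ := (Multiset.range a).map fun k => 2 * (a - k) - 1

/-- The partition `(2a, 2a-2, …, 4, 2)`. -/
def evensDown (a : ℕ) : Multiset ℕ := (Multiset.range a).map fun k => 2 * (a - k)

/-- `p⁻`: decrease the smallest part of `p` by 1 (deleting it if it was 1). -/
def pMinus (p : Multiset ℕ) : Multiset ℕ :=
  match p.sort (· ≤ ·) with
  | [] => 0
  | a :: rest => (↑rest : Multiset ℕ) + (if a ≤ 1 then 0 else {a - 1})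

/-- A partition is symplectic if every odd part occurs with even multiplicity. -/
def IsSymplectic (p : Multiset ℕ) : Prop := ∀ x : ℕ, Odd x → Even (p.count x)

/-- A partition is orthogonal if every even part occurs with even multiplicity. -/
def IsOrthogonal (p : Multiset ℕ) : Prop := ∀ x : ℕ, Even x → Even (p.count x)

/-- `IsCCollapse p q`: `q` is the C-collapse `p_C` of `p`, i.e. the unique maximal
symplectic partition of the same total that is `≤ p` in the dominance order. -/
def IsCCollapse (p q : Multiset ℕ) : Prop :=
  IsPartition q ∧ IsSymplectic q ∧ q.sum = p.sum ∧ DomLE q p ∧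
    ∀ r : Multiset ℕ, IsPartition r → IsSymplectic r → r.sum = p.sum → DomLE r p → DomLE r q

theorem List.Sublist.sum_le_sum_take {l l' : List ℕ} (hl : l.Pairwise (· ≥ ·)) (h : l'.Sublist l)
    {j : ℕ} (hj : l'.length ≤ j) : l'.sum ≤ (l.take j).sum := by
  induction l generalizing l' j with
  | nil => simp [List.sublist_nil.1 h]
  | cons a l ih =>
    rw [List.pairwise_cons] at hl
    rcases l' with _ | ⟨b, t⟩
    · simp
    · obtain ⟨k, rfl⟩ : ∃ k, j = k + 1 := ⟨j - 1, by simp at hj; omega⟩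
      have hb : b ≤ a := by
        rcases List.mem_cons.1 (h.subset List.mem_cons_self) with rfl | hb
        · exact le_rfl
        · exact hl.1 b hb
      have ht : t.sum ≤ (l.take k).sum := ih hl.2 h.tail (by simpa using hj)
      simp only [List.take_succ_cons, List.sum_cons]
      omega

theorem Multiset.sum_le_sum_take_of_le_coe {l : List ℕ} {s : Multiset ℕ}
    (hl : l.Pairwise (· ≥ ·)) (h : s ≤ (l : Multiset ℕ)) {j : ℕ} (hj : s.card ≤ j) :
    s.sum ≤ (l.take j).sum := by
  induction s using Quotient.inductionOn with
  | h t =>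
    obtain ⟨u, hu, hul⟩ := Multiset.coe_le.1 h
    have hu' : u.length ≤ j := by simpa [hu.length_eq] using hj
    simpa [hu.sum_eq] using hul.sum_le_sum_take hl hu'

theorem List.sum_zipWith_add {l m : List ℕ} (h : l.length = m.length) :
    (List.zipWith (· + ·) l m).sum = l.sum + m.sum := by
  induction l generalizing m with
  | nil => simp [List.length_eq_zero_iff.1 h.symm]
  | cons a l ih =>
    rcases m with _ | ⟨b, m⟩
    · simp at h
    · simp [ih (m := m) (by simpa using h)]
      omega

theorem List.Pairwise.zipWith_add {l m : List ℕ} (hl : l.Pairwise (· ≥ ·))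
    (hm : m.Pairwise (· ≥ ·)) : (List.zipWith (· + ·) l m).Pairwise (· ≥ ·) := by
  rw [List.pairwise_iff_getElem] at *
  intro i j hi hj hij
  simp only [List.length_zipWith, lt_inf_iff] at hi hj
  simp only [List.getElem_zipWith]
  exact add_le_add (hl i j hi.1 hj.1 hij) (hm i j hi.2 hj.2 hij)

theorem coe_descList (p : Multiset ℕ) : (descList p : Multiset ℕ) = p := by
  simp [descList]

theorem length_descList (p : Multiset ℕ) : (descList p).length = p.card := by
  simp [descList]

theorem pairwise_descList (p : Multiset ℕ) : (descList p).Pairwise (· ≥ ·) := by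
  simp [descList, List.pairwise_reverse]

theorem Multiset.sum_le_topSum {s p : Multiset ℕ} (h : s ≤ p) {j : ℕ} (hj : s.card ≤ j) :
    s.sum ≤ topSum p j :=
  Multiset.sum_le_sum_take_of_le_coe (pairwise_descList p) (by rwa [coe_descList]) hj

theorem exists_le_sum_eq_topSum (p : Multiset ℕ) (j : ℕ) :
    ∃ s ≤ p, s.card ≤ j ∧ s.sum = topSum p j := by
  refine ⟨((descList p).take j : List ℕ), ?_, by simp, by simp [topSum]⟩
  conv_rhs => rw [← coe_descList p]
  exact Multiset.coe_le.2 (List.take_sublist _ _).subperm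

theorem topSum_mono (p : Multiset ℕ) : Monotone (topSum p) := by
  intro j k hjk
  obtain ⟨s, hs, hsj, hsum⟩ := exists_le_sum_eq_topSum p j
  exact hsum ▸ Multiset.sum_le_topSum hs (hsj.trans hjk)

theorem pairwise_padDesc (p : Multiset ℕ) (n : ℕ) : (padDesc p n).Pairwise (· ≥ ·) := by
  simp [padDesc, List.pairwise_append, pairwise_descList, List.pairwise_replicate]

theorem length_padDesc {p : Multiset ℕ} {n : ℕ} (h : p.card ≤ n) : (padDesc p n).length = n := by
  simp [padDesc, length_descList, h]

theorem sum_take_padDesc (p : Multiset ℕ) (n j : ℕ) : ((padDesc p n).take j).sum = topSum p j := by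
  simp [padDesc, List.take_append, topSum]

theorem Multiset.sum_filter_ne_zero (s : Multiset ℕ) : (s.filter (· ≠ 0)).sum = s.sum := by
  induction s using Multiset.induction_on with
  | empty => simp
  | cons a s ih => by_cases h : a = 0 <;> simp_all

theorem topSum_filter_ne_zero (p : Multiset ℕ) (j : ℕ) :
    topSum (p.filter (· ≠ 0)) j = topSum p j := by
  apply le_antisymm
  · obtain ⟨s, hs, hsj, hsum⟩ := exists_le_sum_eq_topSum (p.filter (· ≠ 0)) j
    exact hsum ▸ Multiset.sum_le_topSum (hs.trans (Multiset.filter_le _ _)) hsj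
  · obtain ⟨s, hs, hsj, hsum⟩ := exists_le_sum_eq_topSum p j
    rw [← hsum, ← Multiset.sum_filter_ne_zero]
    exact Multiset.sum_le_topSum (Multiset.filter_le_filter _ hs)
      ((Multiset.card_le_card (Multiset.filter_le _ _)).trans hsj)

theorem topSum_coe {l : List ℕ} (hl : l.Pairwise (· ≥ ·)) (j : ℕ) :
    topSum (l : Multiset ℕ) j = (l.take j).sum := by
  have : descList (l : Multiset ℕ) = l :=
    (Multiset.coe_eq_coe.1 (coe_descList l)).eq_of_pairwise' (pairwise_descList _) hl
  rw [topSum, this]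

theorem topSum_sumParts (p q : Multiset ℕ) (j : ℕ) :
    topSum (sumParts p q) j = topSum p j + topSum q j := by
  rw [sumParts, topSum_filter_ne_zero,
    topSum_coe ((pairwise_padDesc _ _).zipWith_add (pairwise_padDesc _ _)), List.take_zipWith,
    List.sum_zipWith_add, sum_take_padDesc, sum_take_padDesc]
  rw [List.length_take, List.length_take, length_padDesc (le_max_left _ _),
    length_padDesc (le_max_right _ _)]

theorem Multiset.exists_le_add_split {s p q : Multiset ℕ} (h : s ≤ p + q) :
    ∃ t ≤ p, ∃ u ≤ q, s = t + u :=
  ⟨s ∩ p, Multiset.inter_le_right, s - p, by rwa [tsub_le_iff_left],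
    by rw [add_comm, Multiset.sub_add_inter]⟩

/-- for any three partitions, `β₁ + (α ⊔ β₂) ≥ α ⊔ (β₁ + β₂)` in the
dominance order. -/
theorem sumParts_concat_three (α β₁ β₂ : Multiset ℕ)
    (hα : IsPartition α) (hβ₁ : IsPartition β₁) (hβ₂ : IsPartition β₂) :
    DomLE (α + sumParts β₁ β₂) (sumParts β₁ (α + β₂)) := by
  intro j
  obtain ⟨s, hs, hsj, hsum⟩ := exists_le_sum_eq_topSum (α + sumParts β₁ β₂) j
  obtain ⟨t, ht, u, hu, rfl⟩ := Multiset.exists_le_add_split hs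
  obtain ⟨v, hv, hvu, hvsum⟩ := exists_le_sum_eq_topSum β₂ u.card
  rw [Multiset.card_add] at hsj
  have hβ₁_le : topSum β₁ u.card ≤ topSum β₁ j := topSum_mono β₁ (by omega)
  have hu_le := Multiset.sum_le_topSum hu le_rfl
  have htv := Multiset.sum_le_topSum (add_le_add ht hv) (j := j)
    (by rw [Multiset.card_add]; omega)
  rw [topSum_sumParts] at hu_le ⊢
  rw [Multiset.sum_add] at hsum htv
  omega
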